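/- For every real parameter s, every f : ℝ → [0, ∞], and every real x > 0, one has V_s[B_s[f]](x) + U_s[f](x) = V_s[U_s[f]](x) + V_s[f](x). (This is the operator identity (V_s − I) U_s = V_s (B_s − I) written in subtraction-free form.) -/

import Mathlib

open scoped ENNReal

/-- The Ruelle operator `U_s` : `U_s[f](x) = Σ_{k≥1} (1/(1+2^k x))^s · f(1/(1+2^k x))`. -/
noncomputable def opU (s : ℝ) (f : ℝ → ℝ≥0∞) (x : ℝ) : ℝ≥0∞ :=
  ∑' k : ℕ,
    ENNReal.ofReal ((1 / (1 + 2 ^ (k + 1) * x)) ^ s) * f (1 / (1 + 2 ^ (k + 1) * x))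

/-- The operator `Ũ_s` : `Ũ_s[f](x) = x^{-s} · U_s[f](1/x)`. -/
noncomputable def opUt (s : ℝ) (f : ℝ → ℝ≥0∞) (x : ℝ) : ℝ≥0∞ :=
  ENNReal.ofReal (x ^ (-s)) * opU s f (1 / x)

/-- The binary Euclidean operator `B_s = U_s + Ũ_s`. -/
noncomputable def opB (s : ℝ) (f : ℝ → ℝ≥0∞) (x : ℝ) : ℝ≥0∞ :=
  opU s f x + opUt s f x

/-- Vallée's operator `V_s` :
`V_s[f](x) = Σ_{k≥1} Σ_{a odd, 0 < a < 2^k} (1/(a+2^k x))^s · f(1/(a+2^k x))`. -/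
noncomputable def opV (s : ℝ) (f : ℝ → ℝ≥0∞) (x : ℝ) : ℝ≥0∞ :=
  ∑' k : ℕ, ∑' a : ℕ,
    if Odd a ∧ 0 < a ∧ a < 2 ^ (k + 1) then
      ENNReal.ofReal ((1 / (a + 2 ^ (k + 1) * x)) ^ s) * f (1 / (a + 2 ^ (k + 1) * x))
    else 0

theorem two_pow_mul_odd_injective {j j' a a' : ℕ} (ha : Odd a) (ha' : Odd a')
    (h : 2 ^ j * a = 2 ^ j' * a') : j = j' ∧ a = a' := by
  have hj : j = j' := by
    have h2 := congrArg (padicValNat 2) h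
    have hz : ∀ {b : ℕ}, Odd b → padicValNat 2 b = 0 := fun hb =>
      padicValNat.eq_zero_of_not_dvd hb.not_two_dvd_nat
    rwa [padicValNat.mul (by positivity) ha.pos.ne', padicValNat.mul (by positivity) ha'.pos.ne',
      padicValNat.prime_pow, padicValNat.prime_pow, hz ha, hz ha'] at h2
  subst hj
  exact ⟨rfl, Nat.eq_of_mul_eq_mul_left (by positivity) h⟩

theorem one_add_two_pow_mul_mem {k a j : ℕ} (h : Odd a ∧ 0 < a ∧ a < 2 ^ (k + 1)) :
    Odd (1 + 2 ^ (j + 1) * a) ∧ 0 < 1 + 2 ^ (j + 1) * a ∧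
      1 + 2 ^ (j + 1) * a < 2 ^ (k + j + 1 + 1) := by
  refine ⟨⟨2 ^ j * a, by ring⟩, by omega, ?_⟩
  have h1 : 2 ^ (j + 1) * (a + 1) ≤ 2 ^ (j + 1) * 2 ^ (k + 1) := Nat.mul_le_mul_left _ h.2.2
  have h2 : 2 ^ (k + j + 1 + 1) = 2 ^ (j + 1) * 2 ^ (k + 1) := by ring
  have h3 : 1 < 2 ^ (j + 1) := Nat.one_lt_two_pow (by omega)
  rw [h2]
  linarith

theorem exists_eq_one_add_two_pow_mul {m b : ℕ} (hb : Odd b) (hbm : b < 2 ^ (m + 1))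
    (hb1 : b ≠ 1) :
    ∃ k a j, (Odd a ∧ 0 < a ∧ a < 2 ^ (k + 1)) ∧ m = k + j + 1 ∧ b = 1 + 2 ^ (j + 1) * a := by
  obtain ⟨c, rfl⟩ := hb
  obtain ⟨j, a, ha, rfl⟩ := Nat.exists_eq_two_pow_mul_odd (n := c) (by omega)
  have hlt : 2 ^ j * a < 2 ^ m := by rw [pow_succ] at hbm; omega
  have hjm : j < m := by
    refine (Nat.pow_lt_pow_iff_right (by norm_num : 1 < 2)).mp (lt_of_le_of_lt ?_ hlt)
    exact Nat.le_mul_of_pos_right _ ha.pos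
  obtain ⟨k, rfl⟩ := Nat.exists_eq_add_of_lt hjm
  refine ⟨k, a, j, ⟨ha, ha.pos, ?_⟩, by omega, by ring⟩
  rw [show j + k + 1 = j + (k + 1) by ring, pow_add 2 j] at hlt
  exact lt_of_mul_lt_mul_left' hlt

/-- Every odd `b < 2 ^ m` is either `1` or uniquely `1 + 2 ^ j * a` with `j ≥ 1` and `a` odd,
`a < 2 ^ (m - j)`; this is the corresponding splitting of sums. -/
theorem tsum_odd_lt_two_pow_split (F : ℕ → ℕ → ℝ≥0∞) :
    (∑' k : ℕ, ∑' a : ℕ, if Odd a ∧ 0 < a ∧ a < 2 ^ (k + 1) then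
        ∑' j : ℕ, F (k + j + 1) (1 + 2 ^ (j + 1) * a) else 0) + ∑' k : ℕ, F k 1 =
      ∑' k : ℕ, ∑' a : ℕ, if Odd a ∧ 0 < a ∧ a < 2 ^ (k + 1) then F k a else 0 := by
  let G : ℕ × ℕ → ℝ≥0∞ := fun p =>
    if Odd p.2 ∧ 0 < p.2 ∧ p.2 < 2 ^ (p.1 + 1) then F p.1 p.2 else 0
  let g : (ℕ × ℕ × ℕ) ⊕ ℕ → ℝ≥0∞ := Sum.elim
    (fun q => if Odd q.2.1 ∧ 0 < q.2.1 ∧ q.2.1 < 2 ^ (q.1 + 1) then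
      F (q.1 + q.2.2 + 1) (1 + 2 ^ (q.2.2 + 1) * q.2.1) else 0) (fun k => F k 1)
  let i : (ℕ × ℕ × ℕ) ⊕ ℕ → ℕ × ℕ := Sum.elim
    (fun q => (q.1 + q.2.2 + 1, 1 + 2 ^ (q.2.2 + 1) * q.2.1)) (fun k => (k, 1))
  have hl : ∀ {k a j : ℕ}, g (.inl (k, a, j)) ≠ 0 → Odd a ∧ 0 < a ∧ a < 2 ^ (k + 1) :=
    fun h => by
      by_contra hc
      exact h (if_neg hc)
  have hG : ∑' p, G p = ∑' q, g q := by
    refine tsum_eq_tsum_of_ne_zero_bij (fun q => i q.1) ?_ ?_ ?_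
    · rintro ⟨⟨k, a, j⟩ | k, h⟩ ⟨⟨k', a', j'⟩ | k', h'⟩ heq
      · simp only [i, Sum.elim_inl, Prod.mk.injEq] at heq
        obtain ⟨hj, rfl⟩ := two_pow_mul_odd_injective (hl h).1 (hl h').1
          (Nat.add_left_cancel heq.2)
        obtain rfl : j = j' := by omega
        obtain rfl : k = k' := by omega
        rfl
      · simp only [i, Sum.elim_inl, Sum.elim_inr, Prod.mk.injEq] at heq
        have := Nat.mul_pos (Nat.two_pow_pos (j + 1)) (hl h).2.1
        omega
      · simp only [i, Sum.elim_inl, Sum.elim_inr, Prod.mk.injEq] at heq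
        have := Nat.mul_pos (Nat.two_pow_pos (j' + 1)) (hl h').2.1
        omega
      · simp only [i, Sum.elim_inr, Prod.mk.injEq] at heq
        simp [heq.1]
    · rintro ⟨m, b⟩ h
      have hmem : Odd b ∧ 0 < b ∧ b < 2 ^ (m + 1) := by
        by_contra hc
        exact h (if_neg hc)
      have hF : F m b ≠ 0 := fun h0 => h ((if_pos hmem).trans h0)
      by_cases hb1 : b = 1
      · subst hb1
        exact ⟨⟨.inr m, hF⟩, rfl⟩
      · obtain ⟨k, a, j, ha, rfl, rfl⟩ :=
          exists_eq_one_add_two_pow_mul hmem.1 hmem.2.2 hb1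
        exact ⟨⟨.inl (k, a, j), fun h0 => hF ((if_pos ha).symm.trans h0)⟩, rfl⟩
    · rintro ⟨⟨k, a, j⟩ | k, h⟩
      · exact (if_pos (one_add_two_pow_mul_mem (hl h))).trans (if_pos (hl h)).symm
      · exact if_pos ⟨odd_one, one_pos, Nat.one_lt_two_pow (by omega)⟩
  calc
    _ = ∑' q, g q := by
      rw [Summable.tsum_sum ENNReal.summable ENNReal.summable]
      simp only [g, Sum.elim_inl, Sum.elim_inr]
      rw [ENNReal.tsum_prod']
      congr 2
      ext k
      rw [ENNReal.tsum_prod']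
      congr 1
      ext a
      split_ifs <;> simp
    _ = ∑' p, G p := hG.symm
    _ = _ := ENNReal.tsum_prod'

theorem opV_add (s : ℝ) (f g : ℝ → ℝ≥0∞) (x : ℝ) :
    opV s (fun y => f y + g y) x = opV s f x + opV s g x := by
  simp only [opV, ← ENNReal.tsum_add]
  congr! 4 with k a
  split_ifs
  · rw [mul_add]
  · simp

theorem ofReal_rpow_mul_opUt (s : ℝ) (f : ℝ → ℝ≥0∞) {y : ℝ} (hy : 0 < y) :
    ENNReal.ofReal ((1 / y) ^ s) * opUt s f (1 / y) = opU s f y := by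
  have hy' : 0 < 1 / y := by positivity
  rw [opUt, one_div_one_div, ← mul_assoc, ← ENNReal.ofReal_mul (by positivity),
    ← Real.rpow_add hy', add_neg_cancel, Real.rpow_zero, ENNReal.ofReal_one, one_mul]

/-- The identity `V_s Ũ_s + U_s = V_s`. -/
theorem opV_opUt_add_opU (s : ℝ) (f : ℝ → ℝ≥0∞) {x : ℝ} (hx : 0 < x) :
    opV s (opUt s f) x + opU s f x = opV s f x := by
  have key := tsum_odd_lt_two_pow_split fun k a =>
    ENNReal.ofReal ((1 / (a + 2 ^ (k + 1) * x)) ^ s) * f (1 / (a + 2 ^ (k + 1) * x))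
  simp only [Nat.cast_one] at key
  rw [opU, opV, opV, ← key]
  congr! 5 with k a
  split_ifs
  · rw [ofReal_rpow_mul_opUt s f (by positivity), opU]
    congr! 2 with j
    have : (1 : ℝ) + 2 ^ (j + 1) * (a + 2 ^ (k + 1) * x) =
        ((1 + 2 ^ (j + 1) * a : ℕ) : ℝ) + 2 ^ (k + j + 1 + 1) * x := by
      push_cast
      ring
    rw [this]
  · rfl

/-- The operator identity `(V_s − I) U_s = V_s (B_s − I)` in subtraction-free
form: `V_s[B_s[f]] + U_s[f] = V_s[U_s[f]] + V_s[f]` pointwise on `(0,∞)`. -/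
theorem opV_opB_add_opU_eq (s : ℝ) (f : ℝ → ℝ≥0∞) (x : ℝ) (hx : 0 < x) :
    opV s (opB s f) x + opU s f x = opV s (opU s f) x + opV s f x := by
  have hB : opV s (opB s f) x = opV s (opU s f) x + opV s (opUt s f) x :=
    opV_add s (opU s f) (opUt s f) x
  rw [hB, add_assoc, opV_opUt_add_opU s f hx]
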